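/- arXiv:2603.11954 — 6 statements merged into one kernel-verified Lean document; each statement's English description precedes it below -/
import Mathlib

section
/- Let t ≥ 1, n ≥ 1, and let α = a_1a_2⋯a_n be a necklace of length n over Σ_t with α ≠ 0^n. Let j be the smallest index with a_j ≠ 0. Then the first non-zero parent γ = 0^{j−1}(a_j−1)a_{j+1}⋯a_n is a necklace; moreover, if α ≠ 0^{n−1}1 then γ is aperiodic. -/
/-- A string (list over `ℕ`) is a necklace if it is lexicographically less than
or equal to each of its cyclic rotations. -/
def IsNecklace (a : List ℕ) : Prop :=
  ∀ i : ℕ, a = a.rotate i ∨ List.Lex (· < ·) a (a.rotate i)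

/-- A string is periodic if it is `m` copies of some string for some `m ≥ 2`. -/
def IsPeriodicStr (a : List ℕ) : Prop :=
  ∃ (b : List ℕ) (m : ℕ), 2 ≤ m ∧ a = (List.replicate m b).flatten

theorem getD_rotate {l : List ℕ} {i k : ℕ} (hk : k < l.length) :
    (l.rotate i).getD k 0 = l.getD ((k + i) % l.length) 0 := by
  have h : (k + i) % l.length < l.length := Nat.mod_lt _ (by omega)
  rw [List.getD_eq_getElem _ _ (by simpa using hk), List.getD_eq_getElem _ _ h,
    List.getElem_rotate]

theorem lex_iff_exists_getD {l l' : List ℕ} (h : l.length = l'.length) :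
    List.Lex (· < ·) l l' ↔
      ∃ d < l.length, (∀ m < d, l.getD m 0 = l'.getD m 0) ∧ l.getD d 0 < l'.getD d 0 := by
  change l < l' ↔ _
  rw [List.lt_iff_exists]
  constructor
  · rintro (⟨-, h'⟩ | ⟨d, h₁, h₂, he, hlt⟩)
    · omega
    · refine ⟨d, h₁, fun m hm => ?_, ?_⟩
      · rw [List.getD_eq_getElem _ _ (by omega), List.getD_eq_getElem _ _ (by omega)]
        exact he m hm
      · rwa [List.getD_eq_getElem _ _ h₁, List.getD_eq_getElem _ _ h₂]
  · rintro ⟨d, h₁, he, hlt⟩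
    refine Or.inr ⟨d, h₁, h ▸ h₁, fun m hm => ?_, ?_⟩
    · have := he m hm
      rwa [List.getD_eq_getElem _ _ (by omega), List.getD_eq_getElem _ _ (by omega)] at this
    · rwa [List.getD_eq_getElem _ _ h₁, List.getD_eq_getElem _ _ (h ▸ h₁)] at hlt

theorem lex_rotate_iff {l : List ℕ} {i : ℕ} :
    List.Lex (· < ·) l (l.rotate i) ↔
      ∃ d < l.length, (∀ m < d, l.getD m 0 = l.getD ((m + i) % l.length) 0) ∧
        l.getD d 0 < l.getD ((d + i) % l.length) 0 := by
  rw [lex_iff_exists_getD (by simp)]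
  refine exists_congr fun d => and_congr_right fun hd => ?_
  rw [getD_rotate hd]
  refine and_congr_left fun _ => forall₂_congr fun m hm => ?_
  rw [getD_rotate (hm.trans hd)]

theorem IsNecklace.of_lex {l : List ℕ}
    (h : ∀ i, 0 < i → i < l.length → List.Lex (· < ·) l (l.rotate i)) : IsNecklace l := by
  intro i
  rw [← List.rotate_mod]
  rcases Nat.eq_zero_or_pos (i % l.length) with h0 | h0
  · simp [h0]
  · rcases Nat.eq_zero_or_pos l.length with hl | hl
    · simp [List.length_eq_zero_iff.mp hl]
    · exact Or.inr (h _ h0 (Nat.mod_lt _ hl))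

theorem not_isPeriodicStr_of_lex {l : List ℕ} (hl : l ≠ [])
    (h : ∀ i, 0 < i → i < l.length → List.Lex (· < ·) l (l.rotate i)) :
    ¬ IsPeriodicStr l := by
  rintro ⟨b, m, hm, rfl⟩
  obtain ⟨k, rfl⟩ : ∃ k, m = k + 2 := ⟨m - 2, by omega⟩
  have hb : 0 < b.length := by
    rcases b with _ | ⟨y, b⟩
    · simp at hl
    · simp
  have hrot : (List.replicate (k + 2) b).flatten.rotate b.length =
      (List.replicate (k + 2) b).flatten := by
    conv_lhs => rw [List.replicate_succ, List.flatten_cons, List.rotate_append_length_eq]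
    rw [List.replicate_succ' (n := k + 1)]
    simp
  have := h b.length hb (by simp; nlinarith)
  rw [hrot, lex_iff_exists_getD rfl] at this
  obtain ⟨d, -, -, hd⟩ := this
  exact lt_irrefl _ hd

/-- Each rotation of a necklace starting with `0 ^ j x`, `x ≠ 0`, has its first nonzero symbol
among its first `j + 1` symbols, and this symbol is at least `x` if it is in place `j`. -/
theorem IsNecklace.exists_first_nonzero {l : List ℕ} (h : IsNecklace l) {j : ℕ}
    (hj : j < l.length) (hzero : ∀ m < j, l.getD m 0 = 0) (hx : l.getD j 0 ≠ 0) (i : ℕ) :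
    ∃ k ≤ j, (∀ m < k, l.getD ((m + i) % l.length) 0 = 0) ∧
      l.getD ((k + i) % l.length) 0 ≠ 0 ∧
      (k = j → l.getD j 0 ≤ l.getD ((k + i) % l.length) 0) := by
  rcases h i with he | hlt
  · have hk : ∀ k < l.length, l.getD ((k + i) % l.length) 0 = l.getD k 0 := fun k hk => by
      rw [← getD_rotate hk, ← he]
    refine ⟨j, le_rfl, fun m hm => ?_, ?_, fun _ => ?_⟩
    · rw [hk m (hm.trans hj), hzero m hm]
    · rwa [hk j hj]
    · rw [hk j hj]
  · obtain ⟨d, hd, he, hlt⟩ := lex_rotate_iff.mp hlt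
    rcases lt_trichotomy d j with hdj | rfl | hdj
    · exact ⟨d, hdj.le, fun m hm => by rw [← he m hm, hzero m (hm.trans hdj)], by omega,
        by omega⟩
    · exact ⟨d, le_rfl, fun m hm => by rw [← he m hm, hzero m hm], by omega, fun _ => hlt.le⟩
    · exact ⟨j, le_rfl, fun m hm => by rw [← he m (hm.trans hdj), hzero m hm],
        by rwa [← he j hdj], fun _ => (he j hdj).le⟩

/-- If the `j`-th symbol, the first nonzero one, of a necklace is decreased by one and the result
is not `0 ^ n`, then the result is strictly smaller than all its nontrivial rotations. -/
theorem IsNecklace.lex_rotate_of_decrease {l g : List ℕ} (h : IsNecklace l)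
    (hlen : g.length = l.length) {j : ℕ} (hj : j < l.length)
    (hzero : ∀ m < j, l.getD m 0 = 0) (hx : l.getD j 0 ≠ 0)
    (hgj : g.getD j 0 = l.getD j 0 - 1) (hg : ∀ m, m ≠ j → g.getD m 0 = l.getD m 0)
    (hne : ∃ p < g.length, g.getD p 0 ≠ 0) {i : ℕ} (hi : 0 < i) (hil : i < g.length) :
    List.Lex (· < ·) g (g.rotate i) := by
  rw [lex_rotate_iff]
  classical
  have hp := Nat.find_spec hne
  have hmin : ∀ m < Nat.find hne, g.getD m 0 = 0 := fun m hm => by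
    by_contra hm0
    exact Nat.find_min hne hm ⟨hm.trans hp.1, hm0⟩
  generalize Nat.find hne = p at hp hmin
  obtain ⟨hpl, hp0⟩ := hp
  have hjp : j ≤ p := by
    by_contra! hpj
    exact hp0 (by rw [hg p hpj.ne, hzero p hpj])
  rcases le_or_gt i p with hip | hip
  · refine ⟨p - i, by omega, fun m hm => ?_, ?_⟩
    · rw [Nat.mod_eq_of_lt (by omega), hmin m (by omega), hmin (m + i) (by omega)]
    · rw [Nat.sub_add_cancel hip, Nat.mod_eq_of_lt hpl, hmin (p - i) (by omega)]
      omega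
  · obtain ⟨k, hkj, hk0, hk, hkx⟩ := h.exists_first_nonzero hj hzero hx i
    have hkn : k + i < l.length := by
      by_contra! hkn
      rw [Nat.mod_eq_sub_mod hkn, Nat.mod_eq_of_lt (by omega)] at hk
      exact hk (hzero _ (by omega))
    rw [Nat.mod_eq_of_lt hkn] at hk hkx
    refine ⟨k, by omega, fun m hm => ?_, ?_⟩
    · have := hk0 m hm
      rw [Nat.mod_eq_of_lt (by omega)] at this
      rw [Nat.mod_eq_of_lt (by omega), hmin m (by omega), hg _ (by omega), this]
    · rw [Nat.mod_eq_of_lt (by omega), hg (k + i) (by omega)]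
      rcases hkj.lt_or_eq with hlt | rfl
      · rw [hmin k (by omega)]
        omega
      · have := hkx rfl
        omega

/-- Let `t ≥ 1`, `n ≥ 1`, and let `α = a_1⋯a_n` be a necklace of
length `n` over `Σ_t` with `α ≠ 0^n`.  Writing `α = 0^{j-1} x a_{j+1}⋯a_n` with
`x ≠ 0` (so `j` is the smallest index with a nonzero symbol), the first non-zero
parent `γ = 0^{j-1}(x-1)a_{j+1}⋯a_n` is a necklace; moreover, if `α ≠ 0^{n-1}1`
then `γ` is aperiodic. -/
theorem stmt0 (t n : ℕ) (ht : 1 ≤ t) (hn : 1 ≤ n) (a : List ℕ)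
    (hlen : a.length = n) (halph : ∀ x ∈ a, x < t)
    (hneck : IsNecklace a) (hne : a ≠ List.replicate n 0)
    (j x : ℕ) (rest : List ℕ)
    (hdecomp : a = List.replicate j 0 ++ x :: rest) (hx : x ≠ 0) :
    IsNecklace (List.replicate j 0 ++ (x - 1) :: rest) ∧
    (a ≠ List.replicate (n - 1) 0 ++ [1] →
      ¬ IsPeriodicStr (List.replicate j 0 ++ (x - 1) :: rest)) := by
  subst hdecomp
  set a := List.replicate j 0 ++ x :: rest with ha
  set g := List.replicate j 0 ++ (x - 1) :: rest with hgdef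
  have hgl : g.length = a.length := by simp [ha, hgdef]
  have hj : j < a.length := by simp [ha]
  have hzero : ∀ m < j, a.getD m 0 = 0 := fun m hm => by
    rw [ha, List.getD_append _ _ _ _ (by simpa using hm)]
    simp [List.getD_eq_getElem?_getD, hm]
  have haj : a.getD j 0 = x := by simp [ha]
  have hgj : g.getD j 0 = a.getD j 0 - 1 := by
    rw [haj]
    simp [hgdef]
  have hg : ∀ m, m ≠ j → g.getD m 0 = a.getD m 0 := fun m hm => by
    rcases lt_or_gt_of_ne hm with hm | hm
    · rw [ha, hgdef, List.getD_append _ _ _ _ (by simpa using hm),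
        List.getD_append _ _ _ _ (by simpa using hm)]
    · obtain ⟨k, rfl⟩ : ∃ k, m = j + k + 1 := ⟨m - j - 1, by omega⟩
      rw [ha, hgdef, List.getD_append_right _ _ _ _ (by simp; omega),
        List.getD_append_right _ _ _ _ (by simp; omega)]
      simp [add_assoc]
  have haj0 : a.getD j 0 ≠ 0 := by rwa [haj]
  by_cases hne' : ∃ p < g.length, g.getD p 0 ≠ 0
  · have hlex : ∀ i, 0 < i → i < g.length → List.Lex (· < ·) g (g.rotate i) := fun i hi hil =>
      hneck.lex_rotate_of_decrease hgl hj hzero haj0 hgj hg hne' hi hil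
    exact ⟨.of_lex hlex, fun _ => not_isPeriodicStr_of_lex (by simp [hgdef]) hlex⟩
  · push Not at hne'
    have hgrep : g = List.replicate g.length 0 := by
      refine List.eq_replicate_iff.mpr ⟨rfl, fun y hy => ?_⟩
      obtain ⟨p, hp, rfl⟩ := List.getElem_of_mem hy
      rw [← List.getD_eq_getElem _ 0 hp, hne' p hp]
    refine ⟨fun i => Or.inl ?_, fun hcontra => absurd ?_ hcontra⟩
    · generalize g.length = c at hgrep
      rw [hgrep, List.rotate_replicate]
    · have hx1 : x = 1 := by
        have := hne' j (by omega)
        omega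
      have hjn : j + 1 = a.length := by
        by_contra hjn
        obtain ⟨k, hkj, -, hk, -⟩ := hneck.exists_first_nonzero hj hzero haj0 (j + 1)
        have hlt : (k + (j + 1)) % a.length < a.length := Nat.mod_lt _ (by omega)
        have hnej : (k + (j + 1)) % a.length ≠ j := by
          rcases lt_or_ge (k + (j + 1)) a.length with hs | hs
          · rw [Nat.mod_eq_of_lt hs]
            omega
          · rw [Nat.mod_eq_sub_mod hs, Nat.mod_eq_of_lt (by omega)]
            omega
        rw [← hg _ hnej] at hk
        exact hk (hne' _ (by omega))
      have hrest : rest = [] := by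
        have : a.length = j + (rest.length + 1) := by simp [ha]
        exact List.length_eq_zero_iff.mp (by omega)
      rw [← hlen, ← hjn, ha, hx1, hrest, Nat.add_sub_cancel]
end

section
/- Let t ≥ 1, n ≥ 1, and let α and β be two distinct necklaces of length n over Σ_t, both different from 0^n, whose first nonzero symbols occur at positions i and j respectively. If α and β have the same first non-zero parent, then i ≠ j; moreover the last symbols of α and of β are both nonzero. -/
theorem not_lex_replicate_zero_append (i x : ℕ) (hx : x ≠ 0) (u v : List ℕ) :
    ¬ (List.replicate i 0 ++ x :: u = List.replicate i 0 ++ 0 :: v ∨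
      List.Lex (· < ·) (List.replicate i 0 ++ x :: u) (List.replicate i 0 ++ 0 :: v)) := by
  induction i with
  | zero => simp [List.cons_lex_cons_iff, hx]
  | succ k ih => simpa [List.replicate_succ, List.cons_lex_cons_iff] using ih

/-- A necklace with a nonzero symbol does not end in zero. -/
theorem IsNecklace.getLast?_ne_zero {i x : ℕ} {r : List ℕ} (hx : x ≠ 0)
    (h : IsNecklace (List.replicate i 0 ++ x :: r)) :
    (List.replicate i 0 ++ x :: r).getLast? ≠ some 0 := by
  intro hlast
  obtain rfl | ⟨s, c, rfl⟩ := r.eq_nil_or_concat'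
  · simp [hx] at hlast
  · have hc : c = 0 := by
      rw [← List.cons_append, ← List.append_assoc, List.getLast?_concat] at hlast
      exact Option.some.inj hlast
    subst hc
    have hrot : (List.replicate i 0 ++ x :: (s ++ [0])).rotate
        (List.replicate i 0 ++ x :: s).length = List.replicate i 0 ++ 0 :: x :: s := by
      rw [← List.cons_append, ← List.append_assoc, List.rotate_append_length_eq,
        List.singleton_append, ← List.cons_append, ← List.replicate_succ,
        List.replicate_succ', List.append_assoc, List.singleton_append]
    have hle := h (List.replicate i 0 ++ x :: s).length
    rw [hrot] at hle
    exact not_lex_replicate_zero_append i x hx _ _ hle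

/-- Let `t ≥ 1`, `n ≥ 1`, and let `α` and `β` be two distinct
necklaces of length `n` over `Σ_t`, both different from `0^n`, written as
`α = 0^i x·ra` and `β = 0^j y·rb` with `x, y ≠ 0` (so their first nonzero
symbols occur at 0-based positions `i` and `j`).  If `α` and `β` have the same
first non-zero parent, then `i ≠ j`; moreover the last symbols of `α` and of
`β` are both nonzero. -/
theorem stmt1 (t n : ℕ) (ht : 1 ≤ t) (hn : 1 ≤ n)
    (a b : List ℕ)
    (halen : a.length = n) (haalph : ∀ x ∈ a, x < t) (haneck : IsNecklace a)
    (hane : a ≠ List.replicate n 0)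
    (hblen : b.length = n) (hbalph : ∀ x ∈ b, x < t) (hbneck : IsNecklace b)
    (hbne : b ≠ List.replicate n 0)
    (hab : a ≠ b)
    (i j x y : ℕ) (ra rb : List ℕ)
    (hda : a = List.replicate i 0 ++ x :: ra) (hx : x ≠ 0)
    (hdb : b = List.replicate j 0 ++ y :: rb) (hy : y ≠ 0)
    (hparent : List.replicate i 0 ++ (x - 1) :: ra
             = List.replicate j 0 ++ (y - 1) :: rb) :
    i ≠ j ∧ a.getLast? ≠ some 0 ∧ b.getLast? ≠ some 0 := by
  subst hda hdb
  refine ⟨?_, haneck.getLast?_ne_zero hx, hbneck.getLast?_ne_zero hy⟩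
  rintro rfl
  have hcons := List.append_cancel_left hparent
  rw [List.cons.injEq] at hcons
  obtain ⟨hxy, rfl⟩ := hcons
  obtain rfl : x = y := by omega
  exact hab rfl
end

section
/- Let t ≥ 1, n ≥ 1, and let α and β be two distinct periodic necklaces of length n over Σ_t, both different from 0^n. Then the first non-zero parent of α is different from the first non-zero parent of β; that is, the first non-zero parent map is injective on the set of periodic necklaces other than 0^n. -/
theorem not_lex_zero_prefix (i x : ℕ) (hx : x ≠ 0) (u v : List ℕ) :
    ¬ List.Lex (· < ·) (List.replicate i 0 ++ x :: u) (List.replicate i 0 ++ 0 :: v) := by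
  induction i with
  | zero =>
    intro h
    cases h with
    | cons h => exact hx rfl
    | rel h => exact Nat.not_lt_zero _ h
  | succ k ih =>
    intro h
    rw [List.replicate_succ, List.cons_append, List.cons_append] at h
    cases h with
    | cons h => exact ih h
    | rel h => exact lt_irrefl _ h

/-- A necklace starting with exactly `i` zeros has no run of `i + 1` zeros. -/
theorem IsNecklace.not_long_zero_run {i x : ℕ} (hx : x ≠ 0) {r p v : List ℕ}
    (h : IsNecklace (List.replicate i 0 ++ x :: r)) :
    List.replicate i 0 ++ x :: r ≠ p ++ (List.replicate i 0 ++ 0 :: v) := by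
  intro he
  have hr : (List.replicate i 0 ++ x :: r).rotate p.length =
      List.replicate i 0 ++ 0 :: (v ++ p) := by
    rw [he, List.rotate_append_length_eq]
    simp
  have hl := h p.length
  rw [hr] at hl
  rcases hl with hl | hl
  · exact hx (List.cons.inj (List.append_cancel_left hl)).1
  · exact not_lex_zero_prefix i x hx _ _ hl

/-- In a periodic string, the leading run of zeros reappears later. -/
theorem IsPeriodicStr.exists_zero_run {j y : ℕ} (hy : y ≠ 0) {r : List ℕ}
    (h : IsPeriodicStr (List.replicate j 0 ++ y :: r)) :
    ∃ s u : List ℕ, r = s ++ (List.replicate j 0 ++ u) := by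
  obtain ⟨c, m, hm, he⟩ := h
  have hc : ¬ ∀ z ∈ c, z = 0 := by
    intro hz
    have hmem : y ∈ (List.replicate m c).flatten := by rw [← he]; simp
    obtain ⟨l, hl, hyl⟩ := List.mem_flatten.1 hmem
    rw [List.eq_of_mem_replicate hl] at hyl
    exact hy (hz y hyl)
  obtain ⟨k, rfl⟩ := Nat.exists_eq_add_of_le' hm
  rw [List.replicate_succ, List.replicate_succ, List.flatten_cons, List.flatten_cons] at he
  rcases List.append_eq_append_iff.1 he with ⟨c', h1, h2⟩ | ⟨c', h1, -⟩
  · cases c' with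
    | nil =>
      refine (hc fun z hz => ?_).elim
      rw [h1, List.append_nil] at hz
      exact List.eq_of_mem_replicate hz
    | cons z s =>
      rw [List.cons_append] at h2
      obtain ⟨rfl, rfl⟩ := List.cons.inj h2
      refine ⟨s, y :: s ++ (List.replicate k c).flatten, ?_⟩
      rw [h1]
      simp
  · refine (hc fun z hz => ?_).elim
    exact List.eq_of_mem_replicate (h1 ▸ List.mem_append_left c' hz)

theorem firstNonzeroParent_ne_of_lt {i j x y : ℕ} {ra rb : List ℕ} (hij : i < j)
    (hx : x ≠ 0) (hy : y ≠ 0) (ha : IsNecklace (List.replicate i 0 ++ x :: ra))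
    (hb : IsPeriodicStr (List.replicate j 0 ++ y :: rb)) :
    List.replicate i 0 ++ (x - 1) :: ra ≠ List.replicate j 0 ++ (y - 1) :: rb := by
  intro h
  obtain ⟨s, u, rfl⟩ := hb.exists_zero_run hy
  obtain ⟨d, rfl⟩ := Nat.exists_eq_add_of_lt hij
  rw [add_assoc, List.replicate_add, List.append_assoc, List.replicate_succ, List.cons_append] at h
  obtain ⟨-, hra⟩ := List.cons.inj (List.append_cancel_left h)
  refine ha.not_long_zero_run hx
    (p := List.replicate i 0 ++ x :: (List.replicate d 0 ++ (y - 1) :: s))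
    (v := List.replicate d 0 ++ u) ?_
  rw [hra]
  simp [List.append_assoc]

/-- Let `t ≥ 1`, `n ≥ 1`, and let `α` and `β` be two distinct
periodic necklaces of length `n` over `Σ_t`, both different from `0^n`, written
as `α = 0^i x·ra` and `β = 0^j y·rb` with `x, y ≠ 0` (so `i`, `j` mark their
first nonzero symbols).  Then the first non-zero parent of `α` differs from the
first non-zero parent of `β`; i.e. the first non-zero parent map is injective
on periodic necklaces other than `0^n`. -/
theorem stmt2 (t n : ℕ) (ht : 1 ≤ t) (hn : 1 ≤ n)
    (a b : List ℕ)
    (halen : a.length = n) (haalph : ∀ x ∈ a, x < t) (haneck : IsNecklace a)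
    (haper : IsPeriodicStr a) (hane : a ≠ List.replicate n 0)
    (hblen : b.length = n) (hbalph : ∀ x ∈ b, x < t) (hbneck : IsNecklace b)
    (hbper : IsPeriodicStr b) (hbne : b ≠ List.replicate n 0)
    (hab : a ≠ b)
    (i j x y : ℕ) (ra rb : List ℕ)
    (hda : a = List.replicate i 0 ++ x :: ra) (hx : x ≠ 0)
    (hdb : b = List.replicate j 0 ++ y :: rb) (hy : y ≠ 0) :
    List.replicate i 0 ++ (x - 1) :: ra ≠ List.replicate j 0 ++ (y - 1) :: rb := by
  subst hda hdb
  rcases lt_trichotomy i j with hij | rfl | hij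
  · exact firstNonzeroParent_ne_of_lt hij hx hy haneck hbper
  · intro h
    obtain ⟨hxy, rfl⟩ := List.cons.inj (List.append_cancel_left h)
    obtain rfl : x = y := by omega
    exact hab rfl
  · exact (firstNonzeroParent_ne_of_lt hij hy hx hbneck haper).symm
end

section
/- For all n ≥ 1, t ≥ 1 and w ≥ 0, the number of periodic necklaces in N_t(n,w) other than 0^n is at most the number of aperiodic necklaces in N_t(n,w); consequently 2·|Σ_t(n,w)| ≥ n·(|N_t(n,w)| − 1). -/
/-- `Σ_t(n,w)`: strings of length `n` over `{0,…,t-1}` with weight at most `w`. -/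
def SigmaSet (t n w : ℕ) : Set (List ℕ) :=
  {a | a.length = n ∧ (∀ x ∈ a, x < t) ∧ a.sum ≤ w}

/-- `N_t(n,w)`: the necklaces in `Σ_t(n,w)`. -/
def NeckSet (t n w : ℕ) : Set (List ℕ) :=
  {a | a ∈ SigmaSet t n w ∧ IsNecklace a}

/-- Rotating a string by one place multiplies its value at an `n`-th root of unity by the
inverse of that root. -/
theorem mul_ofDigits_rotate_one {z : ℂ} {a : List ℕ} (hz : z ^ a.length = 1) :
    z * Nat.ofDigits z (a.rotate 1) = Nat.ofDigits z a := by
  have append_singleton (l : List ℕ) (x : ℕ) :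
      Nat.ofDigits z (l ++ [x]) = Nat.ofDigits z l + z ^ l.length * x := by
    induction l with
    | nil => simp [Nat.ofDigits]
    | cons y l ih =>
      have ih' : Nat.ofDigits z ((y :: l) ++ [x]) = y + z * Nat.ofDigits z (l ++ [x]) := rfl
      have hc : Nat.ofDigits z (y :: l) = y + z * Nat.ofDigits z l := rfl
      rw [ih', ih, hc, List.length_cons]
      ring
  cases a with
  | nil => simp [Nat.ofDigits]
  | cons x l =>
    have hc : Nat.ofDigits z (x :: l) = x + z * Nat.ofDigits z l := rfl
    rw [List.rotate_cons_succ, List.rotate_zero, append_singleton, hc]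
    rw [List.length_cons, pow_succ] at hz
    linear_combination (x : ℂ) * hz

theorem pow_mul_ofDigits_rotate {z : ℂ} {a : List ℕ} (hz : z ^ a.length = 1) (i : ℕ) :
    z ^ i * Nat.ofDigits z (a.rotate i) = Nat.ofDigits z a := by
  induction i with
  | zero => simp
  | succ i ih =>
    have h := mul_ofDigits_rotate_one (z := z) (a := a.rotate i) (by simpa using hz)
    rw [List.rotate_rotate] at h
    rw [← ih, ← h]
    ring

/-- A periodic string is fixed by a nontrivial rotation. -/
theorem IsPeriodicStr.exists_rotate_eq {a : List ℕ} (ha : IsPeriodicStr a) (h0 : a ≠ []) :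
    ∃ i, 0 < i ∧ i < a.length ∧ a.rotate i = a := by
  obtain ⟨b, m, hm, rfl⟩ := ha
  obtain ⟨m, rfl⟩ : ∃ k, m = k + 2 := ⟨m - 2, by omega⟩
  have hb : 0 < b.length := by
    rw [List.length_pos_iff]
    rintro rfl
    simp at h0
  refine ⟨b.length, hb, ?_, ?_⟩
  · simp only [List.length_flatten, List.map_replicate, List.sum_replicate, smul_eq_mul]
    nlinarith
  · conv_lhs => rw [List.replicate_succ, List.flatten_cons, List.rotate_append_length_eq]
    rw [List.replicate_succ' (n := m + 1), List.flatten_append]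
    simp

theorem IsPeriodicStr.ofDigits_eq_zero {z : ℂ} {a : List ℕ} (ha : IsPeriodicStr a)
    (hz : IsPrimitiveRoot z a.length) : Nat.ofDigits z a = 0 := by
  rcases eq_or_ne a [] with rfl | h0
  · rfl
  obtain ⟨i, hi, hil, hrot⟩ := ha.exists_rotate_eq h0
  have h := pow_mul_ofDigits_rotate hz.pow_eq_one i
  rw [hrot] at h
  have h1 : z ^ i ≠ 1 := hz.pow_ne_one_of_pos_of_lt hi.ne' hil
  have h2 : (z ^ i - 1) * Nat.ofDigits z a = 0 := by linear_combination h
  exact (mul_eq_zero.mp h2).resolve_left (sub_ne_zero.mpr h1)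

theorem List.eq_flatten_replicate_of_append_comm {α : Type*} (b : List α) (k : ℕ) (l : List α)
    (hl : l.length = k * b.length) (h : b ++ l = l ++ b) :
    l = (List.replicate k b).flatten := by
  induction k generalizing l with
  | zero => simpa using hl
  | succ k ih =>
    have hpre : b <+: l := by
      refine List.prefix_of_prefix_length_le (List.prefix_append b l)
        (h ▸ List.prefix_append l b) ?_
      rw [hl]
      nlinarith
    obtain ⟨l', rfl⟩ := hpre
    rw [List.replicate_succ, List.flatten_cons, ← ih l']
    · simp only [List.length_append] at hl
      linarith
    · simpa using h

/-- A string fixed by a nontrivial rotation is periodic. -/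
theorem isPeriodicStr_of_rotate_eq {a : List ℕ} {i : ℕ} (hi : 0 < i) (hia : i < a.length)
    (h : a.rotate i = a) : IsPeriodicStr a := by
  have iterate_rotate (k : ℕ) (l : List ℕ) :
      (fun l : List ℕ => l.rotate 1)^[k] l = l.rotate k := by
    induction k with
    | zero => simp
    | succ k ih => rw [Function.iterate_succ_apply', ih, List.rotate_rotate]
  have hd : a.rotate (i.gcd a.length) = a := by
    have h1 : Function.IsPeriodicPt (fun l : List ℕ => l.rotate 1) i a :=
      (iterate_rotate i a).trans h
    have h2 : Function.IsPeriodicPt (fun l : List ℕ => l.rotate 1) a.length a :=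
      (iterate_rotate _ a).trans a.rotate_length
    exact (iterate_rotate _ a).symm.trans (h1.gcd h2)
  set d := i.gcd a.length with hdef
  have hdi : d ≤ i := Nat.gcd_le_left _ hi
  have hd0 : 0 < d := Nat.gcd_pos_of_pos_left _ hi
  obtain ⟨m, hm⟩ : d ∣ a.length := Nat.gcd_dvd_right _ _
  have hlen : (a.take d).length = d := by simp; omega
  refine ⟨a.take d, m, ?_, ?_⟩
  · by_contra hlt
    have : m ≤ 1 := by omega
    nlinarith
  · apply List.eq_flatten_replicate_of_append_comm
    · rw [hlen, hm, mul_comm]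
    · rw [List.rotate_eq_drop_append_take (by omega)] at hd
      calc a.take d ++ a = a.take d ++ (a.drop d ++ a.take d) := by rw [hd]
        _ = a ++ a.take d := by rw [← List.append_assoc, List.take_append_drop]

theorem exists_isNecklace_isRotated (a : List ℕ) : ∃ c, IsNecklace c ∧ a ~r c := by
  have hne : a.cyclicPermutations.toFinset.Nonempty :=
    ⟨a, by simp [List.IsRotated.refl]⟩
  obtain ⟨c, hc, hmin⟩ := Finset.exists_min_image _ id hne
  simp only [List.mem_toFinset, List.mem_cyclicPermutations_iff, id] at hc hmin
  refine ⟨c, fun i => ?_, hc.symm⟩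
  exact (hmin (c.rotate i) ((List.IsRotated.forall c i).trans hc)).eq_or_lt

theorem IsNecklace.eq_of_isRotated {a b : List ℕ} (ha : IsNecklace a) (hb : IsNecklace b)
    (h : a ~r b) : a = b := by
  have key {x y : List ℕ} (hx : IsNecklace x) (hxy : x ~r y) : x ≤ y := by
    obtain ⟨i, rfl⟩ := hxy
    rcases hx i with h | h
    · exact h.le
    · exact le_of_lt (show x < x.rotate i from h)
  exact le_antisymm (key ha h) (key hb h.symm)

theorem SigmaSet.of_isRotated {t n w : ℕ} {a b : List ℕ} (ha : a ∈ SigmaSet t n w)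
    (h : a ~r b) : b ∈ SigmaSet t n w := by
  obtain ⟨h1, h2, h3⟩ := ha
  exact ⟨h.perm.length_eq ▸ h1, fun x hx => h2 x (h.mem_iff.mpr hx), h.perm.sum_eq ▸ h3⟩

theorem finite_sigmaSet (t n w : ℕ) : (SigmaSet t n w).Finite := by
  refine ((List.finite_length_eq (Fin t) n).image (List.map Fin.val)).subset ?_
  rintro a ⟨h1, h2, -⟩
  lift a to List (Fin t) using h2
  exact ⟨a, by simpa using h1, rfl⟩

/-- Decreasing one nonzero symbol of a periodic string yields, up to rotation, an aperiodic
necklace. -/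
theorem exists_aperiodic_necklace {t n w : ℕ} {z : ℂ} (hz : IsPrimitiveRoot z n)
    {a : List ℕ} (ha : a ∈ SigmaSet t n w) (hp : IsPeriodicStr a) (h0 : a ≠ List.replicate n 0) :
    ∃ c, (c ∈ NeckSet t n w ∧ ¬ IsPeriodicStr c) ∧
      ∃ y q, a ~r ((y + 1) :: q) ∧ (y :: q) ~r c ∧ Nat.ofDigits z (y :: q) = -1 := by
  obtain ⟨x, hxa, hx0⟩ : ∃ x ∈ a, x ≠ 0 := by
    by_contra! hall
    exact h0 (List.eq_replicate_iff.mpr ⟨ha.1, hall⟩)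
  obtain ⟨p, s, rfl⟩ := List.append_of_mem hxa
  obtain ⟨y, rfl⟩ := Nat.exists_eq_succ_of_ne_zero hx0
  have hrot : (p ++ (y + 1) :: s) ~r ((y + 1) :: (s ++ p)) := List.isRotated_append
  obtain ⟨c, hc, hyc⟩ := exists_isNecklace_isRotated (y :: (s ++ p))
  have hmem := SigmaSet.of_isRotated ha hrot
  have hmem' : y :: (s ++ p) ∈ SigmaSet t n w := by
    obtain ⟨h1, h2, h3⟩ := hmem
    refine ⟨by simpa using h1, fun x hx => ?_, ?_⟩
    · rcases List.mem_cons.mp hx with rfl | hx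
      · exact (Nat.lt_succ_self _).trans (h2 _ List.mem_cons_self)
      · exact h2 x (List.mem_cons_of_mem _ hx)
    · rw [List.sum_cons] at h3 ⊢
      omega
  have hval : Nat.ofDigits z (y :: (s ++ p)) = -1 := by
    obtain ⟨i, hi⟩ := hrot.symm
    have h := pow_mul_ofDigits_rotate (z := z) (a := (y + 1) :: (s ++ p))
      (by rw [hmem.1]; exact hz.pow_eq_one) i
    rw [hi, hp.ofDigits_eq_zero (by rw [ha.1]; exact hz), mul_zero] at h
    have h1 : Nat.ofDigits z ((y + 1) :: (s ++ p)) =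
        ((y + 1 : ℕ) : ℂ) + z * Nat.ofDigits z (s ++ p) := rfl
    have h2 : Nat.ofDigits z (y :: (s ++ p)) = (y : ℂ) + z * Nat.ofDigits z (s ++ p) := rfl
    rw [h1] at h
    push_cast at h
    linear_combination h2 - h
  refine ⟨c, ⟨⟨SigmaSet.of_isRotated hmem' hyc, hc⟩, fun hper => ?_⟩, y, s ++ p, hrot, hyc, hval⟩
  obtain ⟨i, rfl⟩ := hyc
  have h := pow_mul_ofDigits_rotate (z := z) (a := y :: (s ++ p))
    (by rw [hmem'.1]; exact hz.pow_eq_one) i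
  rw [hper.ofDigits_eq_zero (by rw [List.length_rotate, hmem'.1]; exact hz), hval] at h
  norm_num at h

theorem ncard_periodic_le_ncard_aperiodic (t n w : ℕ) (hn : 1 ≤ n) :
    {a ∈ NeckSet t n w | IsPeriodicStr a ∧ a ≠ List.replicate n 0}.ncard ≤
      {a ∈ NeckSet t n w | ¬ IsPeriodicStr a}.ncard := by
  have hz := Complex.isPrimitiveRoot_exp n (by omega)
  set z := Complex.exp (2 * Real.pi * Complex.I / n)
  have hex (a : List ℕ) (ha : a ∈ {a ∈ NeckSet t n w | IsPeriodicStr a ∧ a ≠ List.replicate n 0}) :=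
    exists_aperiodic_necklace hz ha.1.1 ha.2.1 ha.2.2
  choose! f hf y q hrot hfrot hval using hex
  refine Set.ncard_le_ncard_of_injOn f hf ?_ ((finite_sigmaSet t n w).subset fun a ha => ha.1.1)
  intro a ha b hb hab
  refine ha.1.2.eq_of_isRotated hb.1.2 ?_
  obtain ⟨i, hi⟩ := (hfrot a ha).trans (hab ▸ (hfrot b hb).symm)
  have hlen : (y a :: q a).length = n := (hfrot a ha).perm.length_eq.trans (hf a ha).1.1.1
  have h := pow_mul_ofDigits_rotate (z := z) (a := y a :: q a)
    (by rw [hlen]; exact hz.pow_eq_one) i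
  rw [hi, hval a ha, hval b hb] at h
  have hzi : z ^ i = 1 := by linear_combination -h
  have hdvd : n ∣ i := (hz.pow_eq_one_iff_dvd i).mp hzi
  rw [← List.rotate_mod, hlen, Nat.mod_eq_zero_of_dvd hdvd, List.rotate_zero] at hi
  obtain ⟨hy, hq⟩ := List.cons.inj hi
  have hb' := (hrot b hb).symm
  rw [← hy, ← hq] at hb'
  exact (hrot a ha).trans hb'

/-- The `n` rotations of the aperiodic necklaces are distinct strings. -/
theorem mul_ncard_aperiodic_le (t n w : ℕ) :
    n * {a ∈ NeckSet t n w | ¬ IsPeriodicStr a}.ncard ≤ (SigmaSet t n w).ncard := by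
  have hcard : (Set.Iio n).ncard = n := by
    rw [Set.ncard_eq_toFinset_card']
    simp
  have hprod := Set.ncard_prod (s := {a ∈ NeckSet t n w | ¬ IsPeriodicStr a}) (t := Set.Iio n)
  rw [hcard, mul_comm] at hprod
  rw [← hprod]
  refine Set.ncard_le_ncard_of_injOn (fun p : List ℕ × ℕ => p.1.rotate p.2) ?_ ?_
    (finite_sigmaSet t n w)
  · rintro ⟨a, i⟩ ⟨ha, -⟩
    exact SigmaSet.of_isRotated ha.1.1 ⟨i, rfl⟩
  · rintro ⟨a, i⟩ ⟨ha, hi⟩ ⟨b, j⟩ ⟨hb, hj⟩ hab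
    simp only [Set.mem_Iio] at ha hb hi hj hab
    obtain rfl : a = b := ha.1.2.eq_of_isRotated hb.1.2
      (List.IsRotated.trans ⟨i, hab⟩ (List.IsRotated.forall b j))
    have aux {i j : ℕ} (hj : j < n) (hab : a.rotate i = a.rotate j) : j ≤ i := by
      by_contra! hlt
      refine ha.2 (isPeriodicStr_of_rotate_eq (i := j - i) (by omega) (by rw [ha.1.1.1]; omega) ?_)
      apply List.rotate_injective i
      simp only [List.rotate_rotate]
      rw [Nat.sub_add_cancel hlt.le, hab]
    rw [le_antisymm (aux hi hab.symm) (aux hj hab)]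

/-- For all `n ≥ 1`, `t ≥ 1` and `w ≥ 0`, the number of
periodic necklaces in `N_t(n,w)` other than `0^n` is at most the number of
aperiodic necklaces in `N_t(n,w)`; consequently
`2·|Σ_t(n,w)| ≥ n·(|N_t(n,w)| − 1)`. -/
theorem stmt5 (t n w : ℕ) (ht : 1 ≤ t) (hn : 1 ≤ n) :
    {a ∈ NeckSet t n w | IsPeriodicStr a ∧ a ≠ List.replicate n 0}.ncard ≤
      {a ∈ NeckSet t n w | ¬ IsPeriodicStr a}.ncard ∧
    2 * (SigmaSet t n w).ncard ≥ n * ((NeckSet t n w).ncard - 1) := by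
  have h1 := ncard_periodic_le_ncard_aperiodic t n w hn
  have h2 := mul_ncard_aperiodic_le t n w
  refine ⟨h1, ?_⟩
  have hN : (NeckSet t n w).ncard ≤
      {a ∈ NeckSet t n w | IsPeriodicStr a ∧ a ≠ List.replicate n 0}.ncard +
      {a ∈ NeckSet t n w | ¬ IsPeriodicStr a}.ncard + 1 := by
    have hfin : (NeckSet t n w).Finite := (finite_sigmaSet t n w).subset fun a ha => ha.1
    refine le_trans (Set.ncard_le_ncard (t := insert (List.replicate n 0)
      ({a ∈ NeckSet t n w | IsPeriodicStr a ∧ a ≠ List.replicate n 0} ∪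
      {a ∈ NeckSet t n w | ¬ IsPeriodicStr a})) ?_ ?_)
      ((Set.ncard_insert_le _ _).trans (Nat.add_le_add_right (Set.ncard_union_le _ _) 1))
    · intro a ha
      simp only [Set.mem_insert_iff, Set.mem_union, Set.mem_ofPred_eq]
      tauto
    · exact ((hfin.sep _).union (hfin.sep _)).insert _
  calc n * ((NeckSet t n w).ncard - 1)
      ≤ n * (2 * {a ∈ NeckSet t n w | ¬ IsPeriodicStr a}.ncard) :=
        Nat.mul_le_mul_left n (by omega)
    _ = 2 * (n * {a ∈ NeckSet t n w | ¬ IsPeriodicStr a}.ncard) := by ring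
    _ ≤ 2 * (SigmaSet t n w).ncard := Nat.mul_le_mul_left 2 h2
end

section
/- Let n ≥ 1, t ≥ 2 and 0 ≤ w < t, and let α = a_1a_2⋯a_n ∈ Σ_t(n,w) with missing symbol z = w − wt(α). Then the MSR shift MSR(α) = a_2⋯a_n z also lies in Σ_t(n,w), its missing symbol equals a_1, and appending the missing symbol commutes with rotation: the length-(n+1) string MSR(α)·a_1 is the left cyclic rotation of the length-(n+1) string α·z. Consequently, the shorthand bijection α ↦ α·(w − wt(α)) carries orbits of the MSR on Σ_t(n,w) to rotation classes of length-(n+1) strings over Σ_t of weight exactly w. -/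
/-- The missing symbol register: `a_1a_2⋯a_n ↦ a_2⋯a_n z` where `z = w − wt(α)`
is the missing symbol. -/
def msr (w : ℕ) (a : List ℕ) : List ℕ := a.tail ++ [w - a.sum]

theorem msr_mem_sigmaSet {t n w : ℕ} (hn : 1 ≤ n) (hw : w < t) {a : List ℕ}
    (ha : a ∈ SigmaSet t n w) : msr w a ∈ SigmaSet t n w := by
  obtain ⟨hl, ht, hs⟩ := ha
  cases a with
  | nil => simp at hl; omega
  | cons x l =>
    simp only [List.length_cons, List.sum_cons, List.mem_cons, forall_eq_or_imp] at hl ht hs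
    refine ⟨by simpa [msr] using hl, ?_, ?_⟩
    · intro y hy
      simp only [msr, List.tail_cons, List.mem_append, List.mem_singleton] at hy
      rcases hy with hy | rfl
      · exact ht.2 y hy
      · omega
    · simp only [msr, List.tail_cons, List.sum_append, List.sum_cons, List.sum_nil]
      omega

theorem sub_sum_msr {t n w : ℕ} (hn : 1 ≤ n) {a : List ℕ} (ha : a ∈ SigmaSet t n w) :
    w - (msr w a).sum = a.headD 0 := by
  obtain ⟨hl, -, hs⟩ := ha
  cases a with
  | nil => simp at hl; omega
  | cons x l =>
    simp only [msr, List.tail_cons, List.sum_append, List.sum_cons, List.sum_nil,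
      List.headD_cons] at hs ⊢
    omega

theorem msr_append_headD (w : ℕ) {a : List ℕ} (ha : a ≠ []) :
    msr w a ++ [a.headD 0] = (a ++ [w - a.sum]).rotate 1 := by
  cases a with
  | nil => exact absurd rfl ha
  | cons x l => simp [msr]

theorem iterate_msr_append_missing {t n w : ℕ} (hn : 1 ≤ n) (hw : w < t) {a : List ℕ}
    (ha : a ∈ SigmaSet t n w) (m : ℕ) :
    (msr w)^[m] a ++ [w - ((msr w)^[m] a).sum] = (a ++ [w - a.sum]).rotate m := by
  induction m generalizing a with
  | zero => simp
  | succ m ih =>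
    have hne : a ≠ [] := List.ne_nil_of_length_pos (by rw [ha.1]; omega)
    rw [Function.iterate_succ_apply, ih (msr_mem_sigmaSet hn hw ha), sub_sum_msr hn ha,
      msr_append_headD w hne, List.rotate_rotate, Nat.add_comm]

/-- Let `n ≥ 1`, `t ≥ 2` and `0 ≤ w < t`, and let
`α = a_1⋯a_n ∈ Σ_t(n,w)` with missing symbol `z = w − wt(α)`.  Then
`MSR(α) = a_2⋯a_n z` also lies in `Σ_t(n,w)`, its missing symbol equals `a_1`,
and appending the missing symbol commutes with rotation:
`MSR(α)·a_1` is the left cyclic rotation of `α·z`.  Consequently, the shorthand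
bijection `α ↦ α·(w − wt(α))` carries orbits of the MSR on `Σ_t(n,w)` to
rotation classes of length-`(n+1)` strings over `Σ_t` of weight exactly `w`. -/
theorem stmt10 (t n w : ℕ) (ht : 2 ≤ t) (hn : 1 ≤ n) (hw : w < t) :
    (∀ a ∈ SigmaSet t n w,
      msr w a ∈ SigmaSet t n w ∧
      w - (msr w a).sum = a.headD 0 ∧
      msr w a ++ [a.headD 0] = (a ++ [w - a.sum]).rotate 1) ∧
    (∀ a ∈ SigmaSet t n w, ∀ b ∈ SigmaSet t n w,
      ((∃ m : ℕ, (msr w)^[m] a = b) ↔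
        ∃ m : ℕ, (a ++ [w - a.sum]).rotate m = b ++ [w - b.sum])) := by
  refine ⟨fun a ha => ⟨msr_mem_sigmaSet hn hw ha, sub_sum_msr hn ha,
    msr_append_headD w (List.ne_nil_of_length_pos (by rw [ha.1]; omega))⟩,
    fun a ha b _ => exists_congr fun m => ?_⟩
  rw [← iterate_msr_append_missing hn hw ha m]
  refine ⟨fun h => by rw [h], fun h => List.append_inj_left' h rfl⟩
end

section
/- For all n ≥ k ≥ 1, there exists a cyclic sequence u_1u_2⋯u_m of length m = C(n,k) over the alphabet {1,2,…,n−k+1} (indices taken modulo m) such that the map sending each position i to the set { u_i + u_{i+1} + ⋯ + u_{i+j−1} : 1 ≤ j ≤ k } of partial sums of the cyclic window of length k starting at position i is a bijection from the m positions onto the collection of all k-element subsets of {1,2,…,n}; that is, a universal cycle for the k-subsets of [n] under difference representatives exists. -/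
/-- The cyclic window of length `n` of `u` starting at position `i` (0-based). -/
def cycWindow (u : List ℕ) (n i : ℕ) : List ℕ :=
  (List.range n).map fun j => u.getD ((i + j) % u.length) 0

/-- The set of nonempty partial sums of a list of differences. -/
def partialSums : List ℕ → Finset ℕ
  | [] => ∅
  | d :: w => insert d ((partialSums w).image (d + ·))

theorem image_sum_take_eq_partialSums (w : List ℕ) :
    Finset.image (fun j => (w.take j).sum) (Finset.Icc 1 w.length) = partialSums w := by
  induction w with
  | nil => rfl
  | cons d w ih =>
    ext x
    simp only [partialSums, ← ih, Finset.mem_image, Finset.mem_Icc, Finset.mem_insert,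
      List.length_cons, exists_exists_and_eq_and]
    constructor
    · rintro ⟨j, ⟨hj, hjw⟩, rfl⟩
      obtain ⟨j, rfl⟩ := Nat.exists_eq_add_of_le' hj
      rcases Nat.eq_zero_or_pos j with rfl | hpos
      · left; simp
      · right; exact ⟨j, ⟨hpos, by omega⟩, by simp⟩
    · rintro (rfl | ⟨j, ⟨hj, hjw⟩, rfl⟩)
      · exact ⟨1, ⟨le_rfl, by omega⟩, by simp⟩
      · exact ⟨j + 1, ⟨by omega, by omega⟩, by simp⟩

theorem pos_of_mem_partialSums {w : List ℕ} (hw : ∀ x ∈ w, 1 ≤ x) :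
    ∀ x ∈ partialSums w, 1 ≤ x := by
  cases w with
  | nil => simp [partialSums]
  | cons d w =>
    have hd : 1 ≤ d := hw d (by simp)
    simp only [partialSums, Finset.mem_insert, Finset.mem_image]
    rintro x (rfl | ⟨y, -, rfl⟩) <;> omega

theorem notMem_image_partialSums {d : ℕ} {w : List ℕ} (hw : ∀ x ∈ w, 1 ≤ x) :
    d ∉ (partialSums w).image (d + ·) := by
  simp only [Finset.mem_image, not_exists, not_and]
  intro y hy h
  have := pos_of_mem_partialSums hw y hy
  omega

theorem card_partialSums {w : List ℕ} (hw : ∀ x ∈ w, 1 ≤ x) :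
    (partialSums w).card = w.length := by
  induction w with
  | nil => rfl
  | cons d w ih =>
    have hw' : ∀ x ∈ w, 1 ≤ x := fun x hx => hw x (by simp [hx])
    rw [partialSums, Finset.card_insert_of_notMem (notMem_image_partialSums hw'),
      Finset.card_image_of_injective _ (add_right_injective d), ih hw', List.length_cons]

theorem le_sum_of_mem_partialSums {w : List ℕ} : ∀ x ∈ partialSums w, x ≤ w.sum := by
  induction w with
  | nil => simp [partialSums]
  | cons d w ih =>
    simp only [partialSums, Finset.mem_insert, Finset.mem_image, List.sum_cons]
    rintro x (rfl | ⟨y, hy, rfl⟩)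
    · omega
    · have := ih y hy
      omega

theorem sum_mem_partialSums {w : List ℕ} (hw : w ≠ []) : w.sum ∈ partialSums w := by
  induction w with
  | nil => exact absurd rfl hw
  | cons d w ih =>
    rcases eq_or_ne w [] with rfl | h
    · simp [partialSums]
    · simp only [partialSums, Finset.mem_insert, Finset.mem_image, List.sum_cons]
      exact Or.inr ⟨_, ih h, rfl⟩

theorem partialSums_injOn : Set.InjOn partialSums {w | ∀ x ∈ w, 1 ≤ x} := by
  intro w
  induction w with
  | nil =>
    rintro - (_ | ⟨d, w⟩) - h
    · rfl
    · exact absurd h.symm (Finset.insert_ne_empty _ _)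
  | cons d w ih =>
    rintro hw (_ | ⟨d', w'⟩) hw' h
    · exact absurd h (Finset.insert_ne_empty _ _)
    · have h1 : ∀ x ∈ w, 1 ≤ x := fun x hx => hw x (by simp [hx])
      have h2 : ∀ x ∈ w', 1 ≤ x := fun x hx => hw' x (by simp [hx])
      simp only [partialSums] at h
      have hd : d = d' := by
        have e1 : d ∈ insert d' ((partialSums w').image (d' + ·)) := h ▸ Finset.mem_insert_self _ _
        have e2 : d' ∈ insert d ((partialSums w).image (d + ·)) := h ▸ Finset.mem_insert_self _ _
        simp only [Finset.mem_insert, Finset.mem_image] at e1 e2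
        rcases e1 with e1 | ⟨a, -, ha⟩
        · exact e1
        · rcases e2 with e2 | ⟨b, -, hb⟩
          · exact e2.symm
          · omega
      subst hd
      have h' := congrArg (Finset.erase · d) h
      simp only [Finset.erase_insert (notMem_image_partialSums h1),
        Finset.erase_insert (notMem_image_partialSums h2)] at h'
      rw [ih h1 h2 (Finset.image_injective (add_right_injective d) h')]

theorem exists_partialSums_eq (s : Finset ℕ) (hs : ∀ x ∈ s, 1 ≤ x) :
    ∃ w : List ℕ, (∀ x ∈ w, 1 ≤ x) ∧ partialSums w = s := by
  induction h : s.card generalizing s with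
  | zero => exact ⟨[], by simp, (Finset.card_eq_zero.mp h).symm⟩
  | succ k ih =>
    have hne : s.Nonempty := Finset.card_pos.mp (by omega)
    set d := s.min' hne with hd
    have hds : d ∈ s := s.min'_mem hne
    have hlt : ∀ x ∈ s.erase d, d < x := fun x hx =>
      Finset.min'_lt_of_mem_erase_min' s hne hx
    obtain ⟨w, hw, hws⟩ := ih ((s.erase d).image (· - d))
      (by
        simp only [Finset.mem_image]
        rintro x ⟨y, hy, rfl⟩
        have := hlt y hy
        omega)
      (by
        rw [Finset.card_image_of_injOn, Finset.card_erase_of_mem hds, h, Nat.add_sub_cancel]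
        intro x hx y hy hxy
        have h1 : d < x := hlt x hx
        have h2 : d < y := hlt y hy
        have hxy' : x - d = y - d := hxy
        omega)
    refine ⟨d :: w, ?_, ?_⟩
    · simp only [List.mem_cons, forall_eq_or_imp]
      exact ⟨hs d hds, hw⟩
    · rw [partialSums, hws, Finset.image_image]
      have : (s.erase d).image ((d + ·) ∘ (· - d)) = s.erase d := by
        conv_rhs => rw [← Finset.image_id (s := s.erase d)]
        refine Finset.image_congr fun x hx => ?_
        exact Nat.add_sub_of_le (hlt x hx).le
      rw [this, Finset.insert_erase hds]

theorem add_length_le_sum_add_one {w : List ℕ} (hw : ∀ x ∈ w, 1 ≤ x) {x : ℕ} (hx : x ∈ w) :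
    x + w.length ≤ w.sum + 1 := by
  obtain ⟨l, r, rfl⟩ := List.append_of_mem hx
  have hl := List.length_le_sum_of_one_le l fun i hi => hw i (by simp [hi])
  have hr := List.length_le_sum_of_one_le r fun i hi => hw i (by simp [hi])
  simp only [List.length_append, List.length_cons, List.sum_append, List.sum_cons]
  omega

/-- The difference representatives of the `k`-subsets of `{1,…,n}`. -/
abbrev DiffWord (n k : ℕ) : Type :=
  {w : List ℕ // w.length = k ∧ (∀ x ∈ w, 1 ≤ x) ∧ w.sum ≤ n}

theorem partialSums_bijOn {n k : ℕ} (hk : 1 ≤ k) :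
    Set.BijOn partialSums {w | w.length = k ∧ (∀ x ∈ w, 1 ≤ x) ∧ w.sum ≤ n}
      {s : Finset ℕ | s.card = k ∧ s ⊆ Finset.Icc 1 n} := by
  refine ⟨?_, fun w hw w' hw' h => partialSums_injOn hw.2.1 hw'.2.1 h, ?_⟩
  · rintro w ⟨hl, hp, hs⟩
    exact ⟨(card_partialSums hp).trans hl, fun x hx => Finset.mem_Icc.mpr
      ⟨pos_of_mem_partialSums hp x hx, (le_sum_of_mem_partialSums x hx).trans hs⟩⟩
  · rintro s ⟨hc, hs⟩
    obtain ⟨w, hp, rfl⟩ := exists_partialSums_eq s fun x hx => (Finset.mem_Icc.mp (hs hx)).1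
    rw [card_partialSums hp] at hc
    refine ⟨w, ⟨hc, hp, ?_⟩, rfl⟩
    have hne : w ≠ [] := by
      rintro rfl
      simp only [List.length_nil] at hc
      omega
    exact (Finset.mem_Icc.mp (hs (sum_mem_partialSums hne))).2

/-- Decoding is a bijection from difference representatives to `k`-subsets. -/
noncomputable def diffWordEquiv {n k : ℕ} (hk : 1 ≤ k) :
    DiffWord n k ≃ {s : Finset ℕ // s ∈ Finset.powersetCard k (Finset.Icc 1 n)} :=
  ((partialSums_bijOn hk).equiv _).trans
    (Equiv.subtypeEquivRight fun s => by
      simp only [Set.mem_ofPred_eq, Finset.mem_powersetCard, and_comm])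

theorem finite_diffWord {n k : ℕ} (hk : 1 ≤ k) : Finite (DiffWord n k) :=
  Finite.of_equiv _ (diffWordEquiv hk).symm

theorem card_diffWord {n k : ℕ} (hk : 1 ≤ k) : Nat.card (DiffWord n k) = n.choose k := by
  rw [Nat.card_congr (diffWordEquiv hk), Nat.card_eq_fintype_card, Fintype.card_coe,
    Finset.card_powersetCard, Nat.card_Icc, Nat.add_sub_cancel]

namespace Equiv.Perm

variable {α : Type*} [Finite α] {σ : Perm α} {x y : α}

theorem SameCycle.of_forall_apply {p : α → Prop} (hp : ∀ w, p w → p (σ w))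
    (h : σ.SameCycle x y) (hx : p x) : p y := by
  obtain ⟨i, -, -, rfl⟩ := h.exists_pow_eq'
  exact Nat.rec hx (fun i ih => by rw [pow_succ', mul_apply]; exact hp _ ih) i

variable [DecidableEq α]

/-- Composing with the transposition of two points in different cycles merges the cycles. -/
theorem sameCycle_mul_swap (hxy : ¬ σ.SameCycle x y) : (σ * swap x y).SameCycle x y := by
  by_contra hn
  set τ := σ * swap x y with hτ
  have hstep : ∀ j : ℕ, τ.SameCycle x ((σ ^ (j + 1)) y) := by
    intro j
    induction j with
    | zero => exact ⟨1, by simp [hτ]⟩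
    | succ j ih =>
      have h1 : (σ ^ (j + 1)) y ≠ y := fun h => hn (h ▸ ih)
      have h2 : (σ ^ (j + 1)) y ≠ x := fun h => hxy (SameCycle.symm ⟨(j + 1 : ℕ), by
        rw [zpow_natCast]; exact h⟩)
      have h3 : τ ((σ ^ (j + 1)) y) = (σ ^ (j + 1 + 1)) y := by
        rw [hτ, mul_apply, swap_apply_of_ne_of_ne h2 h1, pow_succ' σ (j + 1), mul_apply]
      rw [← h3]
      exact sameCycle_apply_right.mpr ih
  have := hstep (orderOf σ - 1)
  rw [Nat.sub_add_cancel (orderOf_pos σ), pow_orderOf_eq_one, one_apply] at this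
  exact hn this

theorem SameCycle.mul_swap (hxy : ¬ σ.SameCycle x y) {w : α} (hw : σ.SameCycle x w) :
    (σ * swap x y).SameCycle x w := by
  have hm := sameCycle_mul_swap hxy
  refine hw.of_forall_apply (p := fun w => (σ * swap x y).SameCycle x w) (fun v hv => ?_) .rfl
  have hσ : σ v = (σ * swap x y) (swap x y v) := by simp
  rw [hσ, sameCycle_apply_right]
  rcases eq_or_ne v x with rfl | hvx
  · rwa [swap_apply_left]
  rcases eq_or_ne v y with rfl | hvy
  · rw [swap_apply_right]
  · rwa [swap_apply_of_ne_of_ne hvx hvy]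

end Equiv.Perm

/-- A permutation of the difference representatives moving every word to one of its shifts. -/
def IsShift {n k : ℕ} (σ : Equiv.Perm (DiffWord n k)) : Prop :=
  ∀ w, ∃ c, (σ w).1 = w.1.tail ++ [c]

theorem exists_isShift {n k : ℕ} (hk : 1 ≤ k) : ∃ σ : Equiv.Perm (DiffWord n k), IsShift σ := by
  have := finite_diffWord (n := n) hk
  let f : DiffWord n k → DiffWord n k := fun w =>
    ⟨w.1.rotate 1, by
      refine ⟨by rw [List.length_rotate, w.2.1], fun x hx => w.2.2.1 x (List.mem_rotate.mp hx), ?_⟩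
      rw [(List.rotate_perm w.1 1).sum_eq]
      exact w.2.2.2⟩
  have hf : Function.Injective f := fun w w' h =>
    Subtype.ext (List.rotate_injective 1 (congrArg Subtype.val h))
  refine ⟨Equiv.ofBijective f (Finite.injective_iff_bijective.mp hf), ?_⟩
  rintro ⟨_ | ⟨a, v⟩, hl, hw⟩
  · simp only [List.length_nil] at hl
    omega
  · exact ⟨a, by simp [f]⟩

theorem IsShift.mul_swap {n k : ℕ} {σ : Equiv.Perm (DiffWord n k)} (hσ : IsShift σ)
    {x y : DiffWord n k} (h : x.1.tail = y.1.tail) : IsShift (σ * Equiv.swap x y) := by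
  intro w
  rw [Equiv.Perm.mul_apply]
  obtain ⟨c, hc⟩ := hσ (Equiv.swap x y w)
  refine ⟨c, hc.trans ?_⟩
  congr 1
  rcases eq_or_ne w x with rfl | hx
  · rw [Equiv.swap_apply_left, h]
  rcases eq_or_ne w y with rfl | hy
  · rw [Equiv.swap_apply_right, h]
  · rw [Equiv.swap_apply_of_ne_of_ne hx hy]

theorem IsShift.mem_of_closed {n k : ℕ} (hk : 1 ≤ k) {σ : Equiv.Perm (DiffWord n k)}
    (hσ : IsShift σ) {p : DiffWord n k → Prop} (hinv : ∀ w, p (σ w) → p w)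
    (htail : ∀ x y : DiffWord n k, x.1.tail = y.1.tail → p x → p y)
    (hone : ∀ w : DiffWord n k, w.1 = List.replicate k 1 → p w) (w : DiffWord n k) : p w := by
  have key : ∀ j ≤ k, ∀ w : DiffWord n k, w.1.drop j = List.replicate (k - j) 1 → p w := by
    intro j
    induction j with
    | zero => exact fun _ w hw => hone w (by simpa using hw)
    | succ j ih =>
      intro hj w hw
      obtain ⟨_ | ⟨a, v⟩, hl, hp, hs⟩ := w
      · simp only [List.length_nil] at hl
        omega
      have ha : 1 ≤ a := hp a (by simp)
      rw [List.length_cons] at hl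
      rw [List.sum_cons] at hs
      rw [List.drop_succ_cons] at hw
      let w' : DiffWord n k := ⟨v ++ [1], by simpa using hl, by
        intro x hx
        rcases List.mem_append.mp hx with hx | hx
        · exact hp x (by simp [hx])
        · exact (List.mem_singleton.mp hx).ge, by
        rw [List.sum_append, List.sum_singleton]
        omega⟩
      have hw' : p w' := by
        refine ih (by omega) w' ?_
        change (v ++ [1]).drop j = _
        rw [List.drop_append_of_le_length (by omega), hw, show k - j = k - (j + 1) + 1 by omega,
          List.replicate_succ']
      refine htail (σ.symm w') _ ?_ (hinv _ (by rwa [Equiv.apply_symm_apply]))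
      obtain ⟨c, hc⟩ := hσ (σ.symm w')
      rw [Equiv.apply_symm_apply] at hc
      exact (List.append_inj_left' hc rfl).symm
  exact key k le_rfl w (by simp [w.2.1])

theorem exists_isShift_forall_sameCycle {n k : ℕ} (hk : 1 ≤ k) (hkn : k ≤ n) :
    ∃ (σ : Equiv.Perm (DiffWord n k)) (z : DiffWord n k),
      IsShift σ ∧ ∀ w, σ.SameCycle z w := by
  classical
  have := finite_diffWord (n := n) hk
  let z : DiffWord n k := ⟨List.replicate k 1, by simp, by simp, by simpa using hkn⟩
  obtain ⟨σ, hσ, hmax⟩ := Set.exists_max_image {σ : Equiv.Perm (DiffWord n k) | IsShift σ}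
    (fun σ => {w | σ.SameCycle z w}.ncard) (Set.toFinite _) (exists_isShift hk)
  refine ⟨σ, z, hσ, IsShift.mem_of_closed hk hσ (fun w hw => ?_) (fun x y hxy hx => ?_)
    (fun w hw => ?_)⟩
  · exact Equiv.Perm.sameCycle_apply_right.mp hw
  · by_contra hy
    have hne : ¬ σ.SameCycle x y := fun h => hy (hx.trans h)
    have hzx := Equiv.Perm.SameCycle.mul_swap hne hx.symm
    refine absurd (hmax _ (hσ.mul_swap hxy)) (not_le.mpr (Set.ncard_lt_ncard ?_ (Set.toFinite _)))
    refine ⟨fun w hw => ?_, fun h => hy (h ?_)⟩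
    · exact hzx.symm.trans (Equiv.Perm.SameCycle.mul_swap hne (hx.symm.trans hw))
    · exact hzx.symm.trans (Equiv.Perm.sameCycle_mul_swap hne)
  · have : w = z := Subtype.ext hw
    rw [this]

theorem IsShift.getD_pow {n k : ℕ} {σ : Equiv.Perm (DiffWord n k)} (hσ : IsShift σ) (j : ℕ) :
    ∀ (w : DiffWord n k) (i : ℕ), i + j < k → ((σ ^ j) w).1.getD i 0 = w.1.getD (i + j) 0 := by
  induction j with
  | zero => simp
  | succ j ih =>
    intro w i hij
    rw [pow_succ, Equiv.Perm.mul_apply, ih _ _ (by omega)]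
    obtain ⟨c, hc⟩ := hσ w
    have hl := w.2.1
    rw [hc, List.getD_append _ _ _ _ (by rw [List.length_tail]; omega)]
    simp [List.getD_eq_getElem?_getD, add_assoc]

/-- For all `n ≥ k ≥ 1`, there exists a cyclic sequence
`u_1⋯u_m` of length `m = C(n,k)` over the alphabet `{1,…,n−k+1}` such that the
map sending each position `i` to the set
`{ u_i + u_{i+1} + ⋯ + u_{i+j−1} : 1 ≤ j ≤ k }` of partial sums of the cyclic
window of length `k` starting at position `i` is a bijection from the `m`
positions onto the `k`-element subsets of `{1,…,n}`; that is, a universal cycle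
for the `k`-subsets of `[n]` under difference representatives exists. -/
theorem stmt13 (n k : ℕ) (hk : 1 ≤ k) (hkn : k ≤ n) :
    ∃ u : List ℕ, u.length = Nat.choose n k ∧
      (∀ x ∈ u, 1 ≤ x ∧ x ≤ n - k + 1) ∧
      Set.BijOn
        (fun i : ℕ =>
          Finset.image (fun j => ((cycWindow u k i).take j).sum) (Finset.Icc 1 k))
        {i : ℕ | i < u.length}
        {s : Finset ℕ | s.card = k ∧ s ⊆ Finset.Icc 1 n} := by
  have := finite_diffWord (n := n) hk
  have := Fintype.ofFinite (DiffWord n k)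
  obtain ⟨σ, z, hσ, hz⟩ := exists_isShift_forall_sameCycle hk hkn
  have hcard : (Finset.univ : Finset (DiffWord n k)).card = n.choose k := by
    rw [Finset.card_univ, ← Nat.card_eq_fintype_card, card_diffWord hk]
  have hcyc : σ.IsCycleOn (Finset.univ : Finset (DiffWord n k)) := by
    rw [Finset.coe_univ]
    exact ⟨Set.bijOn_univ.mpr σ.bijective, fun x _ y _ => (hz x).symm.trans (hz y)⟩
  have hpow : ∀ {a b : ℕ}, (σ ^ a) z = (σ ^ b) z ↔ a ≡ b [MOD n.choose k] := by
    intro a b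
    rw [← hcard]
    exact hcyc.pow_apply_eq_pow_apply (Finset.mem_univ z)
  set u : List ℕ := (List.range (n.choose k)).map fun i => ((σ ^ i) z).1.getD 0 0 with hu
  have hlen : u.length = n.choose k := by simp [hu]
  have hpos : 0 < n.choose k := Nat.choose_pos hkn
  have hwin : ∀ i, cycWindow u k i = ((σ ^ i) z).1 := by
    intro i
    have hl := ((σ ^ i) z).2.1
    refine List.ext_getElem (by simp [cycWindow, hl]) fun j hj hj' => ?_
    have hmod : (σ ^ ((i + j) % n.choose k)) z = (σ ^ j) ((σ ^ i) z) := by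
      rw [← Equiv.Perm.mul_apply, ← pow_add, add_comm j i, hpow]
      exact Nat.mod_modEq _ _
    have hget : u.getD ((i + j) % u.length) 0 =
        ((σ ^ ((i + j) % n.choose k)) z).1.getD 0 0 := by
      have hlt := Nat.mod_lt (i + j) hpos
      rw [hlen, List.getD_eq_getElem _ _ (by rwa [hlen])]
      simp [hu]
    rw [← List.getD_eq_getElem _ 0 hj']
    simp only [cycWindow, List.getElem_map, List.getElem_range]
    rw [hget, hmod, hσ.getD_pow j _ 0 (by omega), zero_add]
  refine ⟨u, hlen, ?_, ?_⟩
  · intro x hx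
    obtain ⟨i, -, rfl⟩ := List.mem_map.mp hx
    obtain ⟨hl, hp, hs⟩ := ((σ ^ i) z).2
    have hmem : ((σ ^ i) z).1.getD 0 0 ∈ ((σ ^ i) z).1 := by
      rw [List.getD_eq_getElem _ _ (by omega)]
      exact List.getElem_mem _
    have hle := add_length_le_sum_add_one hp hmem
    exact ⟨hp _ hmem, by omega⟩
  · have hfun : (fun i : ℕ =>
        Finset.image (fun j => ((cycWindow u k i).take j).sum) (Finset.Icc 1 k)) =
        partialSums ∘ fun i => ((σ ^ i) z).1 := by
      funext i
      rw [hwin, Function.comp_apply, ← image_sum_take_eq_partialSums, ((σ ^ i) z).2.1]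
    rw [hfun, hlen]
    refine (partialSums_bijOn hk).comp ⟨fun i _ => ((σ ^ i) z).2, fun a ha b hb hab => ?_,
      fun w hw => ?_⟩
    · exact Nat.ModEq.eq_of_lt_of_lt (hpow.mp (Subtype.ext hab)) ha hb
    · obtain ⟨i, hi, hiw⟩ := hcyc.exists_pow_eq (Finset.mem_univ z) (Finset.mem_univ ⟨w, hw⟩)
      exact ⟨i, hcard ▸ hi, congrArg Subtype.val hiw⟩
end
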